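/- (Theorem 1, second part.) Under the hypotheses of the first part of Theorem 1 (Algorithm 1 with β_k ≡ β, δ ∈ (0,1), σ ≤ σ_k ≤ √(1+θ_{k−1})σ_{k−1}, Assumption 1 on (M_k), and existence of a saddle point), assume additionally that the restriction of f* to its effective domain is continuous and that (σ_k)_{k∈ℕ} is bounded from above. Then the whole sequence (x^k, y^k)_{k∈ℕ} converges to a saddle point of the problem. -/

import Mathlib

open scoped RealInnerProductSpace
open Filter Topology

/-- Convexity for extended-real-valued functions. -/
def ERealConvexOn {X : Type*} [AddCommGroup X] [Module ℝ X] (g : X → EReal) : Prop :=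
  ∀ ⦃u v : X⦄ ⦃a b : ℝ⦄, 0 ≤ a → 0 ≤ b → a + b = 1 →
    g (a • u + b • v) ≤ (a : EReal) * g u + (b : EReal) * g v

/-- `p = prox^Q_{τg}(w)`: `p` minimizes `z ↦ g(z) + (1/(2τ))‖z − w‖²_Q`. -/
def IsProxPt {E : Type*} [NormedAddCommGroup E] [InnerProductSpace ℝ E]
    (Q : E →L[ℝ] E) (τ : ℝ) (g : E → EReal) (w p : E) : Prop :=
  ∀ z : E,
    g p + ((1 / (2 * τ) * ⟪Q (p - w), p - w⟫ : ℝ) : EReal)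
      ≤ g z + ((1 / (2 * τ) * ⟪Q (z - w), z - w⟫ : ℝ) : EReal)

/-- The value `⟨Kx, y⟩ + g(x) + h(x) − f*(y)` of the saddle-point problem. -/
noncomputable def saddleVal {X Y : Type*}
    [NormedAddCommGroup X] [InnerProductSpace ℝ X]
    [NormedAddCommGroup Y] [InnerProductSpace ℝ Y]
    (K : X →L[ℝ] Y) (g : X → EReal) (h : X → ℝ) (fs : Y → EReal)
    (x : X) (y : Y) : EReal :=
  ((⟪K x, y⟫ : ℝ) : EReal) + g x + ((h x : ℝ) : EReal) - fs y

/-- `(xh, yh)` is a saddle point. -/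
def IsSaddlePoint {X Y : Type*}
    [NormedAddCommGroup X] [InnerProductSpace ℝ X]
    [NormedAddCommGroup Y] [InnerProductSpace ℝ Y]
    (K : X →L[ℝ] Y) (g : X → EReal) (h : X → ℝ) (fs : Y → EReal)
    (xh : X) (yh : Y) : Prop :=
  ∀ (x : X) (y : Y),
    saddleVal K g h fs xh y ≤ saddleVal K g h fs xh yh ∧
    saddleVal K g h fs xh yh ≤ saddleVal K g h fs x yh

theorem EReal.exists_coe_of_ne {a : EReal} (hb : a ≠ ⊥) (ht : a ≠ ⊤) : ∃ r : ℝ, a = r :=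
  ⟨a.toReal, (EReal.coe_toReal ht hb).symm⟩

theorem le_zero_of_forall_le_mul {A C : ℝ} (h : ∀ t : ℝ, 0 < t → t ≤ 1 → A ≤ t * C) : A ≤ 0 := by
  have ht : Tendsto (fun t : ℝ => t * C) (𝓝[>] 0) (𝓝 0) := by
    have : Continuous fun t : ℝ => t * C := by fun_prop
    simpa using (this.tendsto 0).mono_left nhdsWithin_le_nhds
  refine ge_of_tendsto ht ?_
  filter_upwards [Ioc_mem_nhdsGT (zero_lt_one' ℝ)] with t ht using h t ht.1 ht.2

/-- A proximal point lies in the effective domain. -/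
theorem IsProxPt.ne_top {E : Type*} [NormedAddCommGroup E] [InnerProductSpace ℝ E]
    {Q : E →L[ℝ] E} {τ : ℝ} {g : E → EReal} {w p : E}
    (hgbot : ∀ z, g z ≠ ⊥) (hgtop : ∃ z, g z ≠ ⊤) (hp : IsProxPt Q τ g w p) : g p ≠ ⊤ := by
  intro hpt
  obtain ⟨z, hz⟩ := hgtop
  obtain ⟨r, hr⟩ := EReal.exists_coe_of_ne (hgbot z) hz
  have := hp z
  rw [hpt, hr, EReal.top_add_coe, ← EReal.coe_add, top_le_iff] at this
  exact EReal.coe_ne_top _ this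

/-- The variational inequality characterizing a proximal point. -/
theorem IsProxPt.inner_le {E : Type*} [NormedAddCommGroup E] [InnerProductSpace ℝ E]
    {Q : E →L[ℝ] E} {τ : ℝ} {g : E → EReal} {w p : E}
    (hQ : ∀ u v, ⟪Q u, v⟫ = ⟪u, Q v⟫) (hτ : 0 < τ)
    (hgbot : ∀ z, g z ≠ ⊥) (hgtop : ∃ z, g z ≠ ⊤) (hconv : ERealConvexOn g)
    (hp : IsProxPt Q τ g w p) {z : E} (hz : g z ≠ ⊤) :
    ⟪Q (w - p), z - p⟫ ≤ τ * ((g z).toReal - (g p).toReal) := by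
  obtain ⟨r, hr⟩ := EReal.exists_coe_of_ne (hgbot z) hz
  obtain ⟨s, hs⟩ := EReal.exists_coe_of_ne (hgbot p) (hp.ne_top hgbot hgtop)
  suffices hA : ⟪Q (w - p), z - p⟫ - τ * (r - s) ≤ 0 by
    rw [hr, hs, EReal.toReal_coe, EReal.toReal_coe]
    linarith
  refine le_zero_of_forall_le_mul (C := ⟪Q (z - p), z - p⟫ / 2) fun t ht ht1 => ?_
  have hc := hconv (u := p) (v := z) (sub_nonneg.2 ht1) ht.le (by ring)
  have hm := (hp ((1 - t) • p + t • z)).trans (add_le_add_left hc _)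
  rw [hr, hs] at hm
  norm_cast at hm
  have e : (1 - t) • p + t • z - w = t • (z - p) - (w - p) := by module
  have e' : p - w = -(w - p) := by abel
  have hsym : ⟪Q (z - p), w - p⟫ = ⟪Q (w - p), z - p⟫ := by
    rw [hQ, real_inner_comm]
  rw [e, e'] at hm
  simp only [map_sub Q (t • (z - p)), map_neg, map_smul, inner_sub_left,
    inner_sub_right (𝕜 := ℝ) _ (t • (z - p)),
    inner_neg_left, inner_neg_right, real_inner_smul_left, real_inner_smul_right, hsym] at hm
  generalize ⟪Q (w - p), z - p⟫ = a at *
  generalize ⟪Q (w - p), w - p⟫ = b at *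
  generalize ⟪Q (z - p), z - p⟫ = c at *
  have h2 : 2 * τ * s + b ≤ 2 * τ * ((1 - t) * s + t * r) + (t * (t * c) - t * a - (t * a - b)) := by
    have := mul_le_mul_of_nonneg_left hm (by positivity : 0 ≤ 2 * τ)
    field_simp at this
    linarith
  have h3 : 0 ≤ t * (t * (c / 2) - (a - τ * (r - s))) := by nlinarith
  have := nonneg_of_mul_nonneg_right h3 ht
  linarith

/-- Passing to the limit in an inequality involving a lower semicontinuous function. -/
theorem LowerSemicontinuous.toReal_add_le_of_tendsto {E : Type*} [TopologicalSpace E]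
    {f : E → EReal} (hf : LowerSemicontinuous f) (hbot : ∀ z, f z ≠ ⊥)
    {u : ℕ → E} {u₀ : E} (hu : Tendsto u atTop (𝓝 u₀)) (hfu : ∀ j, f (u j) ≠ ⊤)
    {c : ℕ → ℝ} {c₀ r : ℝ} (hc : Tendsto c atTop (𝓝 c₀))
    (h : ∀ j, (f (u j)).toReal + c j ≤ r) :
    f u₀ ≠ ⊤ ∧ (f u₀).toReal + c₀ ≤ r := by
  have key : f u₀ ≤ ((r - c₀ : ℝ) : EReal) := by
    refine le_of_forall_lt fun b hb => ?_
    obtain ⟨b', hbb', hb'⟩ := exists_between hb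
    refine hbb'.trans_le ?_
    have h1 : ∀ᶠ j in atTop, b' ≤ ((r - c j : ℝ) : EReal) := by
      filter_upwards [hu.eventually (hf u₀ b' hb')] with j hj
      refine hj.le.trans ?_
      rw [← EReal.coe_toReal (hfu j) (hbot _), EReal.coe_le_coe_iff]
      linarith [h j]
    have h2 : Tendsto (fun j => ((r - c j : ℝ) : EReal)) atTop (𝓝 ((r - c₀ : ℝ) : EReal)) :=
      (continuous_coe_real_ereal.tendsto _).comp (tendsto_const_nhds.sub hc)
    exact ge_of_tendsto h2 h1
  have ht : f u₀ ≠ ⊤ := (key.trans_lt (EReal.coe_lt_top _)).ne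
  refine ⟨ht, ?_⟩
  rw [← EReal.coe_toReal ht (hbot _), EReal.coe_le_coe_iff] at key
  linarith

/-- A saddle point, in terms of real-valued inequalities on the effective domains. -/
theorem isSaddlePoint_iff {X Y : Type*}
    [NormedAddCommGroup X] [InnerProductSpace ℝ X] [NormedAddCommGroup Y] [InnerProductSpace ℝ Y]
    {K : X →L[ℝ] Y} {g : X → EReal} {h : X → ℝ} {fs : Y → EReal}
    (hgbot : ∀ z, g z ≠ ⊥) (hgtop : ∃ z, g z ≠ ⊤)
    (hfbot : ∀ z, fs z ≠ ⊥) (hftop : ∃ z, fs z ≠ ⊤) {a : X} {b : Y} :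
    IsSaddlePoint K g h fs a b ↔ g a ≠ ⊤ ∧ fs b ≠ ⊤ ∧
      (∀ x, g x ≠ ⊤ → ⟪K a, b⟫ + (g a).toReal + h a ≤ ⟪K x, b⟫ + (g x).toReal + h x) ∧
      (∀ y, fs y ≠ ⊤ → ⟪K a, y⟫ - (fs y).toReal ≤ ⟪K a, b⟫ - (fs b).toReal) := by
  have hreal : ∀ x y, g x ≠ ⊤ → fs y ≠ ⊤ → saddleVal K g h fs x y
      = ((⟪K x, y⟫ + (g x).toReal + h x - (fs y).toReal : ℝ) : EReal) := by
    intro x y hx hy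
    rw [saddleVal, ← EReal.coe_toReal hx (hgbot x), ← EReal.coe_toReal hy (hfbot y)]
    norm_cast
  have htop : ∀ x y, g x = ⊤ → fs y ≠ ⊤ → saddleVal K g h fs x y = ⊤ := by
    intro x y hx hy
    rw [saddleVal, ← EReal.coe_toReal hy (hfbot y), hx, EReal.coe_add_top, EReal.top_add_coe,
      EReal.top_sub_coe]
  have hbot : ∀ x y, fs y = ⊤ → saddleVal K g h fs x y = ⊥ := by
    intro x y hy
    rw [saddleVal, hy, EReal.sub_top]
  constructor
  · intro hs
    obtain ⟨x₀, hx₀⟩ := hgtop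
    obtain ⟨y₀, hy₀⟩ := hftop
    have hb : fs b ≠ ⊤ := by
      intro hb
      have h1 := (hs x₀ y₀).1
      rw [hbot a b hb, le_bot_iff] at h1
      by_cases ha : g a = ⊤
      · rw [htop a y₀ ha hy₀] at h1
        exact top_ne_bot h1
      · rw [hreal a y₀ ha hy₀] at h1
        exact EReal.coe_ne_bot _ h1
    have ha : g a ≠ ⊤ := by
      intro ha
      have h1 := (hs x₀ y₀).2
      rw [htop a b ha hb, hreal x₀ b hx₀ hb, top_le_iff] at h1
      exact EReal.coe_ne_top _ h1
    refine ⟨ha, hb, fun x hx => ?_, fun y hy => ?_⟩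
    · have h1 := (hs x b).2
      rw [hreal a b ha hb, hreal x b hx hb, EReal.coe_le_coe_iff] at h1
      linarith
    · have h1 := (hs a y).1
      rw [hreal a b ha hb, hreal a y ha hy, EReal.coe_le_coe_iff] at h1
      linarith
  · rintro ⟨ha, hb, h1, h2⟩ x y
    constructor
    · by_cases hy : fs y = ⊤
      · rw [hbot a y hy]
        exact bot_le
      · rw [hreal a b ha hb, hreal a y ha hy, EReal.coe_le_coe_iff]
        linarith [h2 y hy]
    · by_cases hx : g x = ⊤
      · rw [htop x b hx hb]
        exact le_top
      · rw [hreal a b ha hb, hreal x b hx hb, EReal.coe_le_coe_iff]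
        linarith [h1 x hx]

/-- Convergence of quasi-Fejér monotone sequences of nonnegative reals. -/
theorem quasiFejer_bounded_and_tendsto {a c η : ℕ → ℝ} (ha : ∀ n, 0 ≤ a n) (hc : ∀ n, 0 ≤ c n)
    (hη : ∀ n, 0 ≤ η n) (hsum : Summable η)
    (h : ∀ n, a (n + 1) ≤ (1 + η n) * (a n - c n)) :
    (∃ C, ∀ n, a n ≤ C) ∧ Tendsto c atTop (𝓝 0) ∧
      ∀ φ : ℕ → ℕ, StrictMono φ → Tendsto (a ∘ φ) atTop (𝓝 0) → Tendsto a atTop (𝓝 0) := by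
  set P : ℕ → ℝ := fun n => ∏ i ∈ Finset.range n, (1 + η i) with hP
  have hP1 : ∀ n, 1 ≤ P n := fun n =>
    Finset.prod_induction _ (fun r : ℝ => 1 ≤ r) (fun _ _ => one_le_mul_of_one_le_of_one_le) le_rfl
      fun i _ => by linarith [hη i]
  have hPpos : ∀ n, 0 < P n := fun n => one_pos.trans_le (hP1 n)
  have hPB : ∀ n, P n ≤ Real.exp (∑' i, η i) := by
    intro n
    calc P n ≤ ∏ i ∈ Finset.range n, Real.exp (η i) :=
          Finset.prod_le_prod (fun i _ => by linarith [hη i])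
            fun i _ => by linarith [Real.add_one_le_exp (η i)]
      _ = Real.exp (∑ i ∈ Finset.range n, η i) := (Real.exp_sum _ _).symm
      _ ≤ _ := Real.exp_le_exp.2 (hsum.sum_le_tsum _ fun i _ => hη i)
  set B := Real.exp (∑' i, η i)
  set b : ℕ → ℝ := fun n => a n / P n with hb
  have hab : ∀ n, a n = P n * b n := fun n => by
    simp only [hb]
    field_simp [(hPpos n).ne']
  have hb0 : ∀ n, 0 ≤ b n := fun n => div_nonneg (ha n) (hPpos n).le
  have hba : ∀ n, b n ≤ a n := fun n => div_le_self (ha n) (hP1 n)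
  have haB : ∀ n, a n ≤ B * b n := fun n => by
    rw [hab]
    exact mul_le_mul_of_nonneg_right (hPB n) (hb0 n)
  have hstep : ∀ n, c n ≤ P n * (b n - b (n + 1)) := by
    intro n
    have h1 := h n
    have h2 : P (n + 1) = P n * (1 + η n) := Finset.prod_range_succ _ _
    rw [hab (n + 1), hab n, h2] at h1
    have h3 : 0 < 1 + η n := by linarith [hη n]
    have h4 : (1 + η n) * (P n * b (n + 1)) ≤ (1 + η n) * (P n * b n - c n) := by linarith
    linarith [le_of_mul_le_mul_left h4 h3]
  have hanti : Antitone b := antitone_nat_of_succ_le fun n => by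
    have := nonneg_of_mul_nonneg_right ((hc n).trans (hstep n)) (hPpos n)
    linarith
  obtain ⟨l, hl⟩ : ∃ l, Tendsto b atTop (𝓝 l) :=
    ⟨_, tendsto_atTop_ciInf hanti ⟨0, by rintro _ ⟨n, rfl⟩; exact hb0 n⟩⟩
  have hB : 0 ≤ B := (Real.exp_pos _).le
  refine ⟨⟨B * b 0, fun n => (haB n).trans (mul_le_mul_of_nonneg_left (hanti n.zero_le) hB)⟩,
    ?_, fun φ hφ hφ0 => ?_⟩
  · have hlim : Tendsto (fun n => B * (b n - b (n + 1))) atTop (𝓝 0) := by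
      simpa using (hl.sub (hl.comp (tendsto_add_atTop_nat 1))).const_mul B
    refine squeeze_zero hc (fun n => (hstep n).trans ?_) hlim
    exact mul_le_mul_of_nonneg_right (hPB n) (sub_nonneg.2 (hanti n.le_succ))
  · have h1 : Tendsto (b ∘ φ) atTop (𝓝 0) := squeeze_zero (fun n => hb0 _) (fun n => hba _) hφ0
    have h2 : l = 0 := tendsto_nhds_unique (hl.comp hφ.tendsto_atTop) h1
    rw [h2] at hl
    exact squeeze_zero ha haB (by simpa using hl.const_mul B)

/-- The one-step energy estimate for the primal-dual iteration. -/
theorem primalDual_energy_step {X Y : Type*}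
    [NormedAddCommGroup X] [InnerProductSpace ℝ X] [FiniteDimensional ℝ X]
    [NormedAddCommGroup Y] [InnerProductSpace ℝ Y] [FiniteDimensional ℝ Y]
    (K : X →L[ℝ] Y) (M : X →L[ℝ] X) (hM : ∀ u v, ⟪M u, v⟫ = ⟪u, M v⟫)
    {β δ s t θ : ℝ} (hβ : 0 < β) (ht : 0 < t) (hθ : 0 ≤ θ) (hst : θ * s = t)
    {x x' a v : X} {y₀ y y' b : Y} {gx ga f₀ f f' fb hx hx' ha : ℝ}
    (hprox_x : ⟪M (x - x')
        - (β * t) • (ContinuousLinearMap.adjoint K (y + θ • (y - y₀)) + v), a - x'⟫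
      ≤ β * t * (ga - gx))
    (hprox_b : ⟪y + t • K x' - y', b - y'⟫ ≤ t * (fb - f'))
    (hprox_next : ⟪y₀ + s • K x - y, y' - y⟫ ≤ s * (f' - f))
    (hprox_prev : ⟪y₀ + s • K x - y, y₀ - y⟫ ≤ s * (f₀ - f))
    (hconv : hx + ⟪v, a - x⟫ ≤ ha)
    (hsaddle : ⟪K a, b⟫ + ga + ha ≤ ⟪K x', b⟫ + gx + hx')
    (hls : β * t * t * ‖K x' - K x‖ ^ 2 + 2 * (β * t) * (hx' - hx - ⟪v, x' - x⟫)
      ≤ δ * ⟪M (x' - x), x' - x⟫) :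
    ⟪M (x' - a), x' - a⟫ + β * ‖y' - b‖ ^ 2
        + 2 * (β * t) * (1 + θ) * (f - fb - ⟪K a, y - b⟫)
      ≤ ⟪M (x - a), x - a⟫ + β * ‖y - b‖ ^ 2
        + 2 * (β * t) * θ * (f₀ - fb - ⟪K a, y₀ - b⟫)
        - ((1 - δ) * ⟪M (x' - x), x' - x⟫ + β * ‖θ • (y - y₀)‖ ^ 2) := by
  have hyoung : 0 ≤ β * ‖y + θ • (y - y₀) - y' + t • (K x' - K x)‖ ^ 2 := by positivity
  have h1 := mul_le_mul_of_nonneg_left hprox_next hθ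
  have h2 := mul_le_mul_of_nonneg_left hprox_prev (mul_nonneg hθ hθ)
  have h1' := mul_le_mul_of_nonneg_left h1 hβ.le
  have h2' := mul_le_mul_of_nonneg_left h2 hβ.le
  have h3 := mul_le_mul_of_nonneg_left hprox_b hβ.le
  have h4 := mul_le_mul_of_nonneg_left hconv (mul_pos hβ ht).le
  have h5 := mul_le_mul_of_nonneg_left hsaddle (mul_pos hβ ht).le
  have hM' : ∀ u v, ⟪M u, v⟫ = ⟪M v, u⟫ := fun u v => (hM u v).trans (real_inner_comm _ _)
  subst hst
  simp only [← real_inner_self_eq_norm_sq, inner_sub_left, inner_sub_right, inner_add_left,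
    inner_add_right, real_inner_smul_left, real_inner_smul_right, map_sub, map_add, map_smul,
    ContinuousLinearMap.adjoint_inner_left] at *
  simp only [real_inner_comm y y₀, real_inner_comm y y', real_inner_comm y b,
    real_inner_comm y₀ y', real_inner_comm y' b, hM' x' x, hM' a x, hM' a x',
    real_inner_comm (K x) (K x'), real_inner_comm (K x) y, real_inner_comm (K x) y',
    real_inner_comm (K x) y₀, real_inner_comm (K x') y, real_inner_comm (K x') y',
    real_inner_comm (K x') y₀, real_inner_comm (K a) y, real_inner_comm (K a) y₀] at *
  linarith

/-- The gradient inequality for a differentiable convex function. -/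
theorem ConvexOn.add_inner_gradient_le {X : Type*} [NormedAddCommGroup X] [InnerProductSpace ℝ X]
    [CompleteSpace X] {h : X → ℝ} {v x : X} (hconv : ConvexOn ℝ Set.univ h)
    (hgrad : HasGradientAt h v x) (z : X) : h x + ⟪v, z - x⟫ ≤ h z := by
  have hc : ConvexOn ℝ Set.univ (h ∘ AffineMap.lineMap (k := ℝ) x z) :=
    hconv.comp_affineMap _
  have hd : HasDerivAt (h ∘ AffineMap.lineMap (k := ℝ) x z) ⟪v, z - x⟫ 0 := by
    have h1 : HasFDerivAt h (InnerProductSpace.toDual ℝ X v)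
        (AffineMap.lineMap (k := ℝ) x z 0) := by
      rw [AffineMap.lineMap_apply_zero]
      exact hgrad.hasFDerivAt
    simpa using h1.comp_hasDerivAt (0 : ℝ) AffineMap.hasDerivAt_lineMap
  have := hc.le_slope_of_hasDerivAt (Set.mem_univ _) (Set.mem_univ _) (zero_lt_one' ℝ) hd
  simp [slope_def_field] at this
  linarith

theorem tendsto_zero_of_mul_norm_sq_le {E : Type*} [NormedAddCommGroup E] {u : ℕ → E} {c : ℕ → ℝ}
    {κ : ℝ} (hκ : 0 < κ) (h : ∀ n, κ * ‖u n‖ ^ 2 ≤ c n) (hc : Tendsto c atTop (𝓝 0)) :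
    Tendsto u atTop (𝓝 0) := by
  rw [tendsto_zero_iff_norm_tendsto_zero]
  have h1 : Tendsto (fun n => ‖u n‖ ^ 2) atTop (𝓝 0) := by
    refine squeeze_zero (fun n => by positivity) (fun n => ?_) (by simpa using hc.const_mul κ⁻¹)
    rw [inv_mul_eq_div, le_div_iff₀ hκ]
    linarith [h n]
  simpa [Real.sqrt_sq, norm_nonneg] using h1.sqrt

/-- Inner products with uniformly bounded operators vanish in the limit if the first argument
does and the second converges. -/
theorem tendsto_inner_clm_zero {E : Type*} [NormedAddCommGroup E] [InnerProductSpace ℝ E]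
    {M : ℕ → E →L[ℝ] E} {C : ℝ} (hM : ∀ n, ‖M n‖ ≤ C) {u v : ℕ → E} {v₀ : E}
    (hu : Tendsto u atTop (𝓝 0)) (hv : Tendsto v atTop (𝓝 v₀)) :
    Tendsto (fun n => ⟪M n (u n), v n⟫) atTop (𝓝 0) := by
  have h1 : Tendsto (fun n => C * ‖u n‖ * ‖v n‖) atTop (𝓝 0) := by
    simpa using (hu.norm.const_mul C).mul hv.norm
  refine squeeze_zero_norm (fun n => ?_) h1
  refine (norm_inner_le_norm _ _).trans ?_
  gcongr
  exact (M n).le_of_opNorm_le (hM n) _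

/-- Products of a bounded nonnegative sequence with a null sequence vanish in the limit. -/
theorem tendsto_mul_zero_of_bounded {r e : ℕ → ℝ} {B : ℝ} (hr : ∀ n, 0 ≤ r n) (hB : ∀ n, r n ≤ B)
    (he : Tendsto e atTop (𝓝 0)) : Tendsto (fun n => r n * e n) atTop (𝓝 0) := by
  refine squeeze_zero_norm (fun n => ?_) (by simpa using he.norm.const_mul B)
  rw [norm_mul, Real.norm_of_nonneg (hr n)]
  exact mul_le_mul_of_nonneg_right (hB n) (norm_nonneg _)

/-- **Theorem 1, second part.** Under the hypotheses of the first part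
of Theorem 1, if additionally `f*` restricted to its effective domain is continuous and
`(σ_k)` is bounded from above, then the whole sequence `(x^k, y^k)` converges to a
saddle point. -/
theorem algorithm_converges_to_saddle_point
    {X Y : Type*} [NormedAddCommGroup X] [InnerProductSpace ℝ X] [FiniteDimensional ℝ X]
    [NormedAddCommGroup Y] [InnerProductSpace ℝ Y] [FiniteDimensional ℝ Y]
    (K : X →L[ℝ] Y)
    (g : X → EReal)
    (hgbot : ∀ z : X, g z ≠ ⊥) (hgtop : ∃ z : X, g z ≠ ⊤)
    (hglsc : LowerSemicontinuous g) (hgconv : ERealConvexOn g)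
    (fs : Y → EReal)
    (hfbot : ∀ z : Y, fs z ≠ ⊥) (hftop : ∃ z : Y, fs z ≠ ⊤)
    (hflsc : LowerSemicontinuous fs) (hfconv : ERealConvexOn fs)
    (h : X → ℝ) (h' : X → X) (L : ℝ)
    (hhconv : ConvexOn ℝ Set.univ h)
    (hgrad : ∀ z : X, HasGradientAt h (h' z) z)
    (hLip : ∀ u v : X, ‖h' u - h' v‖ ≤ L * ‖u - v‖)
    -- Assumption 1 on the metrics
    (α C_M : ℝ) (hα : 0 < α)
    (M Minv : ℕ → X →L[ℝ] X) (η : ℕ → ℝ)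
    (hMsa : ∀ k, ∀ u v : X, ⟪M k u, v⟫ = ⟪u, M k v⟫)
    (hMα : ∀ k, ∀ z : X, α * ‖z‖ ^ 2 ≤ ⟪M k z, z⟫)
    (hMC : ∀ k, ‖M k‖ ≤ C_M)
    (hηnn : ∀ k, 0 ≤ η k) (hηsum : Summable η)
    (hMmono : ∀ k, ∀ z : X, ⟪M (k + 1) z, z⟫ ≤ (1 + η k) * ⟪M k z, z⟫)
    (hMinv1 : ∀ k, (M k).comp (Minv k) = ContinuousLinearMap.id ℝ X)
    (hMinv2 : ∀ k, (Minv k).comp (M k) = ContinuousLinearMap.id ℝ X)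
    -- step sizes
    (β δ σlb : ℝ) (hβ : 0 < β) (hδ : δ ∈ Set.Ioo (0 : ℝ) 1) (hσlb : 0 < σlb)
    (σ θ : ℕ → ℝ)
    (hσpos : ∀ k, 0 < σ k) (hσlbk : ∀ k, σlb ≤ σ k)
    (hθ0 : 0 ≤ θ 0)
    (hθ : ∀ k, 1 ≤ k → θ k = σ k / σ (k - 1))
    (hσub : ∀ k, 1 ≤ k → σ k ≤ Real.sqrt (1 + θ (k - 1)) * σ (k - 1))
    -- the iterates of Algorithm 1
    (x : ℕ → X) (y : ℕ → Y) (ybar : ℕ → Y)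
    (hy : ∀ k, 1 ≤ k →
      IsProxPt (1 : Y →L[ℝ] Y) (σ (k - 1)) fs (y (k - 1) + σ (k - 1) • K (x k)) (y k))
    (hybar : ∀ k, 1 ≤ k → ybar k = y k + θ k • (y k - y (k - 1)))
    (hx : ∀ k, 1 ≤ k →
      IsProxPt (M k) (β * σ k) g
        (x k - (β * σ k) • (Minv k) ((ContinuousLinearMap.adjoint K) (ybar k))
          - (β * σ k) • (Minv k) (h' (x k)))
        (x (k + 1)))
    (hls : ∀ k, 1 ≤ k →
      (β * σ k) * σ k * ‖K (x (k + 1)) - K (x k)‖ ^ 2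
          + 2 * (β * σ k) * (h (x (k + 1)) - h (x k) - ⟪h' (x k), x (k + 1) - x k⟫)
        ≤ δ * ⟪(M k) (x (k + 1) - x k), x (k + 1) - x k⟫)
    -- existence of a saddle point
    (hexists : ∃ p : X × Y, IsSaddlePoint K g h fs p.1 p.2)
    -- additional assumptions for the second part of Theorem 1
    (hfscont : ContinuousOn fs {z : Y | fs z ≠ ⊤})
    (hσub' : ∃ σmax : ℝ, ∀ k, σ k ≤ σmax) :
    ∃ p : X × Y, IsSaddlePoint K g h fs p.1 p.2 ∧
      Tendsto (fun k => (x k, y k)) atTop (𝓝 p) := by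
  obtain ⟨σmax, hσmax⟩ := hσub'
  have hσmaxpos : 0 < σmax := (hσpos 0).trans_le (hσmax 0)
  have hδ1 : 0 < 1 - δ := sub_pos.2 hδ.2
  have hθ' : ∀ n, θ (n + 1) = σ (n + 1) / σ n := fun n => hθ (n + 1) (by omega)
  have hθpos : ∀ n, 0 < θ (n + 1) := fun n => hθ' n ▸ div_pos (hσpos _) (hσpos _)
  obtain ⟨κ, hκ, hθlb⟩ : ∃ κ > 0, ∀ n, κ ≤ θ (n + 1) := by
    refine ⟨σlb / σmax, div_pos hσlb hσmaxpos, fun n => ?_⟩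
    rw [hθ']
    exact div_le_div₀ (hσpos _).le (hσlbk _) (hσpos _) (hσmax _)
  have hθub : ∀ n, θ (n + 1) ≤ σmax / σlb := fun n => by
    rw [hθ']
    exact div_le_div₀ hσmaxpos.le (hσmax _) hσlb (hσlbk _)
  have hMnn : ∀ k z, 0 ≤ ⟪M k z, z⟫ := fun k z => le_trans (by positivity) (hMα k z)
  have hgx : ∀ n, g (x (n + 2)) ≠ ⊤ := fun n => (hx (n + 1) (by omega)).ne_top hgbot hgtop
  have hfy : ∀ n, fs (y (n + 1)) ≠ ⊤ := fun n => (hy (n + 1) (by omega)).ne_top hfbot hftop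
  have hproxy : ∀ n z, fs z ≠ ⊤ → ⟪y n + σ n • K (x (n + 1)) - y (n + 1), z - y (n + 1)⟫
      ≤ σ n * ((fs z).toReal - (fs (y (n + 1))).toReal) := fun n z hz => by
    simpa using (hy (n + 1) (by omega)).inner_le (fun _ _ => rfl) (hσpos n) hfbot hftop hfconv hz
  have hproxx : ∀ n z, g z ≠ ⊤ →
      ⟪M (n + 1) (x (n + 1) - x (n + 2)) - (β * σ (n + 1)) •
          (ContinuousLinearMap.adjoint K (y (n + 1) + θ (n + 1) • (y (n + 1) - y n))
            + h' (x (n + 1))), z - x (n + 2)⟫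
      ≤ β * σ (n + 1) * ((g z).toReal - (g (x (n + 2))).toReal) := fun n z hz => by
    have h1 := (hx (n + 1) (by omega)).inner_le (hMsa _) (mul_pos hβ (hσpos _)) hgbot hgtop
      hgconv hz
    have hinv : ∀ v, M (n + 1) (Minv (n + 1) v) = v := fun v =>
      DFunLike.congr_fun (hMinv1 (n + 1)) v
    rw [hybar (n + 1) (by omega)] at h1
    convert h1 using 2
    simp only [map_sub, map_smul, hinv, Nat.add_sub_cancel]
    module
  -- the energy, its decrement, and its quasi-monotonicity
  set D : X → Y → Y → ℝ := fun a b z => (fs z).toReal - (fs b).toReal - ⟪K a, z - b⟫ with hD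
  set V : X → Y → ℕ → ℝ := fun a b n =>
    ⟪M (n + 2) (x (n + 2) - a), x (n + 2) - a⟫ + β * ‖y (n + 2) - b‖ ^ 2
      + 2 * (β * σ (n + 1)) * (1 + θ (n + 1)) * D a b (y (n + 1)) with hV
  set c : ℕ → ℝ := fun n => (1 - δ) * ⟪M (n + 2) (x (n + 3) - x (n + 2)), x (n + 3) - x (n + 2)⟫
    + β * ‖θ (n + 2) • (y (n + 2) - y (n + 1))‖ ^ 2 with hc
  have hc0 : ∀ n, 0 ≤ c n := fun n =>
    add_nonneg (mul_nonneg hδ1.le (hMnn _ _)) (by positivity)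
  have hDnn : ∀ a b, IsSaddlePoint K g h fs a b → ∀ n, 0 ≤ D a b (y (n + 1)) := by
    intro a b hs n
    have := ((isSaddlePoint_iff hgbot hgtop hfbot hftop).1 hs).2.2.2 _ (hfy n)
    simp only [hD, inner_sub_right]
    linarith
  have hcoef : ∀ n, 0 ≤ 2 * (β * σ (n + 1)) * (1 + θ (n + 1)) := fun n =>
    mul_nonneg (by have := hσpos (n + 1); positivity) (by linarith [hθpos n])
  have hVlb : ∀ a b, IsSaddlePoint K g h fs a b → ∀ n,
      ⟪M (n + 2) (x (n + 2) - a), x (n + 2) - a⟫ + β * ‖y (n + 2) - b‖ ^ 2 ≤ V a b n :=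
    fun a b hs n => le_add_of_nonneg_right (mul_nonneg (hcoef n) (hDnn a b hs n))
  have hVx : ∀ a b, IsSaddlePoint K g h fs a b → ∀ n, α * ‖x (n + 2) - a‖ ^ 2 ≤ V a b n :=
    fun a b hs n => by
      have h1 := hVlb a b hs n
      have h2 := hMα (n + 2) (x (n + 2) - a)
      have h3 : 0 ≤ β * ‖y (n + 2) - b‖ ^ 2 := by positivity
      linarith
  have hVy : ∀ a b, IsSaddlePoint K g h fs a b → ∀ n, β * ‖y (n + 2) - b‖ ^ 2 ≤ V a b n :=
    fun a b hs n => by linarith [hVlb a b hs n, hMnn (n + 2) (x (n + 2) - a)]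
  have hVstep : ∀ a b, IsSaddlePoint K g h fs a b → ∀ n,
      V a b (n + 1) ≤ (1 + η (n + 2)) * (V a b n - c n) := by
    intro a b hs n
    obtain ⟨hga, hfb, hsx, -⟩ := (isSaddlePoint_iff hgbot hgtop hfbot hftop).1 hs
    have hst : θ (n + 2) * σ (n + 1) = σ (n + 2) := by
      rw [hθ' (n + 1)]
      exact div_mul_cancel₀ _ (hσpos _).ne'
    have hE := primalDual_energy_step K (M (n + 2)) (hMsa _) hβ (hσpos (n + 2))
      (hθpos (n + 1)).le hst (hproxx (n + 1) a hga) (hproxy (n + 2) b hfb)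
      (hproxy (n + 1) _ (hfy (n + 2))) (hproxy (n + 1) _ (hfy n))
      (hhconv.add_inner_gradient_le (hgrad (x (n + 2))) a) (hsx _ (hgx (n + 1)))
      (hls (n + 2) (by omega))
    have hcoef_le : σ (n + 2) * θ (n + 2) ≤ σ (n + 1) * (1 + θ (n + 1)) := by
      have h1 := hσub (n + 2) (by omega)
      have h2 : σ (n + 2) ^ 2 ≤ (1 + θ (n + 1)) * σ (n + 1) ^ 2 := by
        have := pow_le_pow_left₀ (hσpos _).le h1 2
        rwa [mul_pow, Real.sq_sqrt (by simpa using by linarith [hθpos n])] at this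
      rw [hθ' (n + 1), mul_div_assoc', div_le_iff₀ (hσpos _)]
      linarith
    have hprev : 2 * (β * σ (n + 2)) * θ (n + 2) * D a b (y (n + 1))
        ≤ 2 * (β * σ (n + 1)) * (1 + θ (n + 1)) * D a b (y (n + 1)) := by
      refine mul_le_mul_of_nonneg_right ?_ (hDnn a b hs n)
      nlinarith
    have hmono := hMmono (n + 2) (x (n + 3) - a)
    have hnew := mul_nonneg (hcoef (n + 1)) (hDnn a b hs (n + 1))
    have hsq : 0 ≤ β * ‖y (n + 3) - b‖ ^ 2 := by positivity
    have h1 := mul_nonneg (hηnn (n + 2)) (add_nonneg hsq hnew)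
    have h2 : ⟪M (n + 2) (x (n + 3) - a), x (n + 3) - a⟫ + β * ‖y (n + 3) - b‖ ^ 2
        + 2 * (β * σ (n + 2)) * (1 + θ (n + 2)) * D a b (y (n + 2)) ≤ V a b n - c n := by
      simp only [hV, hc]
      linarith
    refine le_trans ?_ (mul_le_mul_of_nonneg_left h2 (by linarith [hηnn (n + 2)]))
    simp only [hV]
    linarith
  have hfejer := fun a b hs => quasiFejer_bounded_and_tendsto
    (fun n => le_trans (by positivity) (hVx a b hs n)) hc0 (fun n => hηnn (n + 2))
    ((summable_nat_add_iff 2).2 hηsum) (hVstep a b hs)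
  -- boundedness and asymptotic regularity
  obtain ⟨⟨a, b⟩, hs⟩ := hexists
  obtain ⟨⟨C, hC⟩, hc_lim, -⟩ := hfejer a b hs
  have hdx : Tendsto (fun n => x (n + 3) - x (n + 2)) atTop (𝓝 0) := by
    refine tendsto_zero_of_mul_norm_sq_le (mul_pos hδ1 hα) (fun n => ?_) hc_lim
    have h1 := mul_le_mul_of_nonneg_left (hMα (n + 2) (x (n + 3) - x (n + 2))) hδ1.le
    have h2 : 0 ≤ β * ‖θ (n + 2) • (y (n + 2) - y (n + 1))‖ ^ 2 := by positivity
    simp only [hc]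
    linarith
  have hdθy : Tendsto (fun n => θ (n + 2) • (y (n + 2) - y (n + 1))) atTop (𝓝 0) := by
    refine tendsto_zero_of_mul_norm_sq_le hβ (fun n => ?_) hc_lim
    have h1 := mul_nonneg hδ1.le (hMnn (n + 2) (x (n + 3) - x (n + 2)))
    simp only [hc]
    linarith
  have hdy : Tendsto (fun n => y (n + 2) - y (n + 1)) atTop (𝓝 0) := by
    rw [tendsto_zero_iff_norm_tendsto_zero] at hdθy ⊢
    refine squeeze_zero (fun n => norm_nonneg _) (fun n => ?_)
      (by simpa using hdθy.const_mul κ⁻¹)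
    rw [inv_mul_eq_div, le_div_iff₀ hκ, norm_smul, Real.norm_of_nonneg (hθpos _).le, mul_comm]
    exact mul_le_mul_of_nonneg_right (hθlb _) (norm_nonneg _)
  have hbdd : ∀ n, (x (n + 2), y (n + 2)) ∈
      Metric.closedBall a (Real.sqrt (C / α)) ×ˢ Metric.closedBall b (Real.sqrt (C / β)) := by
    intro n
    refine ⟨?_, ?_⟩
    · rw [mem_closedBall_iff_norm]
      refine Real.le_sqrt_of_sq_le ?_
      rw [le_div_iff₀ hα]
      linarith [hVx a b hs n, hC n]
    · rw [mem_closedBall_iff_norm]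
      refine Real.le_sqrt_of_sq_le ?_
      rw [le_div_iff₀ hβ]
      linarith [hVy a b hs n, hC n]
  have := FiniteDimensional.proper_real X
  have := FiniteDimensional.proper_real Y
  obtain ⟨⟨xs, ys⟩, -, φ, hφ, hlim⟩ := tendsto_subseq_of_bounded
    (Metric.isBounded_closedBall.prod Metric.isBounded_closedBall) hbdd
  have hx2 : Tendsto (fun j => x (φ j + 2)) atTop (𝓝 xs) :=
    (continuous_fst.tendsto _).comp hlim
  have hy2 : Tendsto (fun j => y (φ j + 2)) atTop (𝓝 ys) :=
    (continuous_snd.tendsto _).comp hlim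
  have hdxφ := hdx.comp hφ.tendsto_atTop
  have hdyφ := hdy.comp hφ.tendsto_atTop
  have hdθyφ := hdθy.comp hφ.tendsto_atTop
  have hx3 : Tendsto (fun j => x (φ j + 3)) atTop (𝓝 xs) := by
    simpa using hdxφ.add hx2
  have hy1 : Tendsto (fun j => y (φ j + 1)) atTop (𝓝 ys) := by
    simpa using hy2.sub hdyφ
  have hybar2 : Tendsto (fun j => y (φ j + 2) + θ (φ j + 2) • (y (φ j + 2) - y (φ j + 1))) atTop
      (𝓝 ys) := by
    simpa using hy2.add hdθyφ
  have hh'cont : Continuous h' := by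
    have : LipschitzWith (Real.toNNReal L) h' := LipschitzWith.of_dist_le_mul fun u v => by
      rw [dist_eq_norm, dist_eq_norm]
      exact (hLip u v).trans (mul_le_mul_of_nonneg_right (Real.le_coe_toNNReal L) (norm_nonneg _))
    exact this.continuous
  -- optimality of the cluster point
  have hlimy : ∀ z, fs z ≠ ⊤ → fs ys ≠ ⊤ ∧ (fs ys).toReal + ⟪K xs, z - ys⟫ ≤ (fs z).toReal := by
    intro z hz
    have hzero : Tendsto (fun j => (σ (φ j + 1))⁻¹ * ⟪y (φ j + 1) - y (φ j + 2), z - y (φ j + 2)⟫)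
        atTop (𝓝 0) := by
      refine tendsto_mul_zero_of_bounded (fun j => (inv_pos.2 (hσpos _)).le)
        (fun j => inv_anti₀ hσlb (hσlbk _)) ?_
      simpa using (hy1.sub hy2).inner (tendsto_const_nhds.sub hy2)
    have hmain : Tendsto (fun j => ⟪K (x (φ j + 2)), z - y (φ j + 2)⟫) atTop
        (𝓝 ⟪K xs, z - ys⟫) :=
      ((K.continuous.tendsto _).comp hx2).inner (tendsto_const_nhds.sub hy2)
    have hsum := hzero.add hmain
    rw [zero_add] at hsum
    refine hflsc.toReal_add_le_of_tendsto hfbot hy2 (fun j => hfy _) hsum fun j => ?_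
    have h1 := hproxy (φ j + 1) z hz
    have hpos := hσpos (φ j + 1)
    rw [add_sub_right_comm, inner_add_left, real_inner_smul_left] at h1
    have h2 := mul_le_mul_of_nonneg_left h1 (inv_pos.2 hpos).le
    rw [mul_add, inv_mul_cancel_left₀ hpos.ne', inv_mul_cancel_left₀ hpos.ne'] at h2
    linarith
  have hlimx : ∀ z, g z ≠ ⊤ → g xs ≠ ⊤ ∧
      (g xs).toReal - ⟪ContinuousLinearMap.adjoint K ys + h' xs, z - xs⟫ ≤ (g z).toReal := by
    intro z hz
    have hzero : Tendsto (fun j => (β * σ (φ j + 2))⁻¹ *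
        ⟪M (φ j + 2) (x (φ j + 2) - x (φ j + 3)), z - x (φ j + 3)⟫) atTop (𝓝 0) := by
      refine tendsto_mul_zero_of_bounded (fun j => (inv_pos.2 (mul_pos hβ (hσpos _))).le)
        (fun j => inv_anti₀ (mul_pos hβ hσlb) (mul_le_mul_of_nonneg_left (hσlbk _) hβ.le)) ?_
      exact tendsto_inner_clm_zero (fun j => hMC _) (by simpa using hx2.sub hx3)
        (tendsto_const_nhds.sub hx3)
    have hmain : Tendsto (fun j => ⟪ContinuousLinearMap.adjoint K
        (y (φ j + 2) + θ (φ j + 2) • (y (φ j + 2) - y (φ j + 1))) + h' (x (φ j + 2)),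
          z - x (φ j + 3)⟫) atTop (𝓝 ⟪ContinuousLinearMap.adjoint K ys + h' xs, z - xs⟫) :=
      ((((ContinuousLinearMap.adjoint K).continuous.tendsto _).comp hybar2).add
        ((hh'cont.tendsto _).comp hx2)).inner (tendsto_const_nhds.sub hx3)
    have hsum := hzero.sub hmain
    rw [zero_sub] at hsum
    refine hglsc.toReal_add_le_of_tendsto hgbot hx3 (fun j => hgx _) hsum fun j => ?_
    have h1 := hproxx (φ j + 1) z hz
    have hpos := mul_pos hβ (hσpos (φ j + 2))
    rw [inner_sub_left, real_inner_smul_left] at h1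
    have h2 := mul_le_mul_of_nonneg_left h1 (inv_pos.2 hpos).le
    rw [mul_sub, inv_mul_cancel_left₀ hpos.ne', inv_mul_cancel_left₀ hpos.ne'] at h2
    linarith
  have hfys : fs ys ≠ ⊤ := (hlimy _ hftop.choose_spec).1
  have hsad : IsSaddlePoint K g h fs xs ys := by
    refine (isSaddlePoint_iff hgbot hgtop hfbot hftop).2
      ⟨(hlimx _ hgtop.choose_spec).1, hfys, fun z hz => ?_, fun z hz => ?_⟩
    · have h1 := (hlimx z hz).2
      have h2 := hhconv.add_inner_gradient_le (hgrad xs) z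
      rw [inner_add_left, ContinuousLinearMap.adjoint_inner_left, map_sub, inner_sub_right,
        real_inner_comm, real_inner_comm (K xs)] at h1
      linarith
    · have h1 := (hlimy z hz).2
      rw [inner_sub_right] at h1
      linarith
  -- the energy with respect to the cluster point vanishes along the subsequence
  have hDlim : Tendsto (fun j => D xs ys (y (φ j + 1))) atTop (𝓝 0) := by
    have h1 : Tendsto (fun j => fs (y (φ j + 1))) atTop (𝓝 (fs ys)) :=
      (hfscont ys hfys).tendsto.comp
        (tendsto_nhdsWithin_iff.2 ⟨hy1, Eventually.of_forall fun j => hfy _⟩)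
    have h2 := (EReal.tendsto_toReal hfys (hfbot ys)).comp h1
    have h3 : Tendsto (fun j => ⟪K xs, y (φ j + 1) - ys⟫) atTop (𝓝 ⟪K xs, ys - ys⟫) :=
      tendsto_const_nhds.inner (hy1.sub_const _)
    simpa using (h2.sub_const (fs ys).toReal).sub h3
  have hVφ : Tendsto (V xs ys ∘ φ) atTop (𝓝 0) := by
    have h1 : Tendsto (fun j => ⟪M (φ j + 2) (x (φ j + 2) - xs), x (φ j + 2) - xs⟫) atTop (𝓝 0) :=
      tendsto_inner_clm_zero (fun j => hMC _) (by simpa using hx2.sub_const xs) (hx2.sub_const xs)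
    have h2 : Tendsto (fun j => β * ‖y (φ j + 2) - ys‖ ^ 2) atTop (𝓝 0) := by
      simpa using ((hy2.sub_const ys).norm.pow 2).const_mul β
    have h3 : Tendsto (fun j => 2 * (β * σ (φ j + 1)) * (1 + θ (φ j + 1)) * D xs ys (y (φ j + 1)))
        atTop (𝓝 0) := by
      refine tendsto_mul_zero_of_bounded (fun j => hcoef _)
        (B := 2 * (β * σmax) * (1 + σmax / σlb)) (fun j => ?_) hDlim
      have := hθpos (φ j)
      have := hθub (φ j)
      have := hσmax (φ j + 1)
      gcongr
    have h4 := (h1.add h2).add h3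
    rwa [add_zero, add_zero] at h4
  have hV0 := (hfejer xs ys hsad).2.2 φ hφ hVφ
  refine ⟨(xs, ys), hsad, Tendsto.prodMk_nhds ?_ ?_⟩
  · rw [← tendsto_add_atTop_iff_nat 2]
    exact tendsto_sub_nhds_zero_iff.1 (tendsto_zero_of_mul_norm_sq_le hα (hVx xs ys hsad) hV0)
  · rw [← tendsto_add_atTop_iff_nat 2]
    exact tendsto_sub_nhds_zero_iff.1 (tendsto_zero_of_mul_norm_sq_le hβ (hVy xs ys hsad) hV0)
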